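/- (Touching of the dipole.) There exists a constant M₁ > 0 such that for every M ∈ (0, M₁), every ω ∈ S_M satisfying the Steiner symmetry condition, and every W > 0 with ω = 1_{{x ∈ ℝ²₊ : 𝒢[ω](x) − W·x₂ > 0}} a.e. in ℝ²₊, there exists ε > 0 such that {x ∈ ℝ²₊ : |x| < ε} ⊆ {x ∈ ℝ²₊ : 𝒢[ω](x) − W·x₂ > 0}. -/

import Mathlib

open MeasureTheory Real Set NNReal Filter Topology

noncomputable section

/-- The upper half plane `ℝ²₊`. -/
def H : Set (ℝ × ℝ) := {p | 0 < p.2}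

/-- The half-plane Green function
`G(x,y) = (1/(4π)) log(1 + 4 x₂ y₂ / |x-y|²)` (Euclidean distance). -/
def G (x y : ℝ × ℝ) : ℝ :=
  (1 / (4 * π)) * Real.log (1 + 4 * x.2 * y.2 / ((x.1 - y.1) ^ 2 + (x.2 - y.2) ^ 2))

/-- The potential `𝒢[ω](x) = ∫_{ℝ²₊} G(x,y) ω(y) dy`. -/
def Gpot (ω : ℝ × ℝ → ℝ) (x : ℝ × ℝ) : ℝ := ∫ y in H, G x y * ω y

/-- The kinetic energy `E(ω) = (1/2) ∫∫ G(x,y) ω(x) ω(y) dy dx`. -/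
def energy (ω : ℝ × ℝ → ℝ) : ℝ :=
  (1 / 2) * ∫ x in H, ∫ y in H, G x y * ω x * ω y

/-- The `L¹(ℝ²₊)` norm (mass). -/
def norm1 (ω : ℝ × ℝ → ℝ) : ℝ := ∫ x in H, |ω x|

/-- The `L²(ℝ²₊)` norm. -/
def norm2 (ω : ℝ × ℝ → ℝ) : ℝ := (∫ x in H, ω x ^ 2) ^ ((1 : ℝ) / 2)

/-- The impulse `‖x₂ ω‖₁ = ∫_{ℝ²₊} x₂ |ω(x)| dx`. -/
def impulse (ω : ℝ × ℝ → ℝ) : ℝ := ∫ x in H, x.2 * |ω x|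

/-- `ω ∈ (L¹ ∩ L²)(ℝ²₊)`. -/
def MemL1L2 (ω : ℝ × ℝ → ℝ) : Prop :=
  Integrable ω (volume.restrict H) ∧ Integrable (fun x => ω x ^ 2) (volume.restrict H)

/-- Finiteness of the impulse `‖x₂ ω‖₁ < ∞`. -/
def ImpulseFinite (ω : ℝ × ℝ → ℝ) : Prop :=
  Integrable (fun x : ℝ × ℝ => x.2 * |ω x|) (volume.restrict H)

/-- The admissible class `K_M`: patches `ω = 1_A` a.e. on `ℝ²₊` with
impulse `∫_A x₂ = M` and mass `|A| ≤ 1`. -/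
def memK (M : ℝ) (ω : ℝ × ℝ → ℝ) : Prop :=
  Integrable ω (volume.restrict H) ∧
  ∃ A : Set (ℝ × ℝ), A ⊆ H ∧ MeasurableSet A ∧
    (∀ᵐ x ∂volume.restrict H, ω x = A.indicator (fun _ => (1 : ℝ)) x) ∧
    (∫ x in A, x.2) = M ∧ volume A ≤ 1

/-- The admissible class `K_{M,∞}`: patches `ω = 1_A` a.e. on `ℝ²₊` with
impulse `∫_A x₂ = M`, without any mass bound. -/
def memKinf (M : ℝ) (ω : ℝ × ℝ → ℝ) : Prop :=
  Integrable ω (volume.restrict H) ∧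
  ∃ A : Set (ℝ × ℝ), A ⊆ H ∧ MeasurableSet A ∧
    (∀ᵐ x ∂volume.restrict H, ω x = A.indicator (fun _ => (1 : ℝ)) x) ∧
    (∫ x in A, x.2) = M

/-- The relaxed admissible class `K̃_M`: measurable `0 ≤ ω ≤ 1` with
mass `≤ 1` and impulse `≤ M`. -/
def memKt (M : ℝ) (ω : ℝ × ℝ → ℝ) : Prop :=
  Integrable ω (volume.restrict H) ∧
  (∀ᵐ x ∂volume.restrict H, 0 ≤ ω x ∧ ω x ≤ 1) ∧
  norm1 ω ≤ 1 ∧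
  Integrable (fun x : ℝ × ℝ => x.2 * |ω x|) (volume.restrict H) ∧
  impulse ω ≤ M

/-- The set of maximizers `S_M` of the energy over `K_M`. -/
def memS (M : ℝ) (ω : ℝ × ℝ → ℝ) : Prop :=
  memK M ω ∧ ∀ ω' : ℝ × ℝ → ℝ, memK M ω' → energy ω' ≤ energy ω

/-- The maximal energy `I_M` over `K_M`. -/
def Isup (M : ℝ) : ℝ := sSup (energy '' {ω | memK M ω})

/-- The maximal energy `I_{1,∞}` over `K_{1,∞}`. -/
def IsupInf : ℝ := sSup (energy '' {ω | memKinf 1 ω})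

/-- The Steiner symmetry condition for a set `Ω ⊆ ℝ²₊`. -/
def SteinerSet (Ω : Set (ℝ × ℝ)) : Prop :=
  (∀ x₁ x₂ : ℝ, 0 < x₂ → (((x₁, x₂) : ℝ × ℝ) ∈ Ω ↔ ((-x₁, x₂) : ℝ × ℝ) ∈ Ω)) ∧
  (∀ x₂ : ℝ, 0 < x₂ → ∀ a b : ℝ, 0 ≤ a → a ≤ b →
    ((b, x₂) : ℝ × ℝ) ∈ Ω → ((a, x₂) : ℝ × ℝ) ∈ Ω)

/-- The Steiner symmetry condition for a nonnegative function on `ℝ²₊`. -/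
def SteinerFn (f : ℝ × ℝ → ℝ) : Prop :=
  (∀ x₁ x₂ : ℝ, 0 < x₂ → f (x₁, x₂) = f (-x₁, x₂)) ∧
  (∀ x₂ : ℝ, 0 < x₂ → ∀ a b : ℝ, 0 ≤ a → a ≤ b → f (b, x₂) ≤ f (a, x₂))

/-- The Poisson kernel of the half-plane, up to the factor `1 / π`. -/
def poissonKernel₀ (a t : ℝ) : ℝ := a / (t ^ 2 + a ^ 2)

lemma continuous_poissonKernel₀ {a : ℝ} (ha : 0 < a) : Continuous (poissonKernel₀ a) := by
  unfold poissonKernel₀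
  exact continuous_const.div (by fun_prop) fun t => by positivity

lemma poissonKernel₀_nonneg {a : ℝ} (ha : 0 ≤ a) (t : ℝ) : 0 ≤ poissonKernel₀ a t := by
  unfold poissonKernel₀; positivity

lemma poissonKernel₀_le {a s t : ℝ} (ha : 0 < a) (h : s ^ 2 ≤ t ^ 2) :
    poissonKernel₀ a t ≤ poissonKernel₀ a s := by
  unfold poissonKernel₀
  gcongr

lemma integral_poissonKernel₀ {a : ℝ} (ha : 0 < a) (u v : ℝ) :
    ∫ t in u..v, poissonKernel₀ a t = arctan (v / a) - arctan (u / a) := by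
  have h : ∀ t, poissonKernel₀ a t = a⁻¹ * (1 + (t / a) ^ 2)⁻¹ := fun t => by
    unfold poissonKernel₀; field_simp; ring
  simp_rw [h]
  rw [intervalIntegral.integral_const_mul,
    intervalIntegral.integral_comp_div (fun t => (1 + t ^ 2)⁻¹) ha.ne',
    integral_inv_one_add_sq, smul_eq_mul, inv_mul_cancel_left₀ ha.ne']

lemma integral_poissonKernel₀_shift_le_of_nonneg {a l x : ℝ} (ha : 0 < a) (hl : 0 ≤ l)
    (hx : 0 ≤ x) :
    ∫ t in (x - l)..(x + l), poissonKernel₀ a t ≤ ∫ t in (-l)..l, poissonKernel₀ a t := by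
  have hi : ∀ u v, IntervalIntegrable (poissonKernel₀ a) volume u v :=
    fun u v => (continuous_poissonKernel₀ ha).intervalIntegrable u v
  have h1 : ∫ t in l..(x + l), poissonKernel₀ a t = ∫ s in (0 : ℝ)..x, poissonKernel₀ a (s + l) := by
    rw [intervalIntegral.integral_comp_add_right (poissonKernel₀ a) l, zero_add]
  have h2 : ∫ t in (-l)..(x - l), poissonKernel₀ a t
      = ∫ s in (0 : ℝ)..x, poissonKernel₀ a (s - l) := by
    rw [intervalIntegral.integral_comp_sub_right (poissonKernel₀ a) l, zero_sub]
  have h3 : ∫ s in (0 : ℝ)..x, poissonKernel₀ a (s + l)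
      ≤ ∫ s in (0 : ℝ)..x, poissonKernel₀ a (s - l) := by
    have hc := continuous_poissonKernel₀ ha
    refine intervalIntegral.integral_mono_on hx
      (Continuous.intervalIntegrable (by fun_prop) _ _)
      (Continuous.intervalIntegrable (by fun_prop) _ _) fun s hs => ?_
    refine poissonKernel₀_le ha ?_
    nlinarith [hs.1, mul_nonneg hs.1 hl]
  have h4 := intervalIntegral.integral_add_adjacent_intervals (hi (-l) (x - l)) (hi (x - l) (x + l))
  have h5 := intervalIntegral.integral_add_adjacent_intervals (hi (-l) l) (hi l (x + l))
  linarith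

lemma integral_poissonKernel₀_shift_le {a b l x : ℝ} (hb : 0 < b) (hab : b ≤ a) (hl : 0 ≤ l) :
    ∫ t in (-l)..l, poissonKernel₀ a (x - t) ≤ ∫ t in (-l)..l, poissonKernel₀ b t := by
  have ha : 0 < a := hb.trans_le hab
  have hab' : ∫ t in (-l)..l, poissonKernel₀ a t ≤ ∫ t in (-l)..l, poissonKernel₀ b t := by
    rw [integral_poissonKernel₀ ha, integral_poissonKernel₀ hb, neg_div, neg_div, arctan_neg,
      arctan_neg]
    have := arctan_strictMono.monotone (div_le_div_of_nonneg_left hl hb hab)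
    linarith
  refine le_trans ?_ hab'
  rw [intervalIntegral.integral_comp_sub_left (poissonKernel₀ a) x, sub_neg_eq_add]
  rcases le_total 0 x with hx | hx
  · exact integral_poissonKernel₀_shift_le_of_nonneg ha hl hx
  · have h := integral_poissonKernel₀_shift_le_of_nonneg ha hl (neg_nonneg.2 hx)
    have h' := intervalIntegral.integral_comp_neg (a := x - l) (b := x + l) (poissonKernel₀ a)
    have he : ∀ t, poissonKernel₀ a (-t) = poissonKernel₀ a t := fun t => by
      simp [poissonKernel₀]
    simp_rw [he] at h'
    rw [h', show -(x + l) = -x - l by ring, show -(x - l) = -x + l by ring]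
    exact h

lemma setLIntegral_poissonKernel₀_Ioc_le {a b l x : ℝ} (hb : 0 < b) (hab : b ≤ a) (hl : 0 ≤ l) :
    ∫⁻ t in Ioc (-l) l, ENNReal.ofReal (poissonKernel₀ a (x - t))
      ≤ ∫⁻ t in Ioc (-l) l, ENNReal.ofReal (poissonKernel₀ b t) := by
  have ha : 0 < a := hb.trans_le hab
  have hca := continuous_poissonKernel₀ ha
  have hcb := continuous_poissonKernel₀ hb
  have hca' : Continuous fun t => poissonKernel₀ a (x - t) := by fun_prop
  rw [← ofReal_integral_eq_lintegral_ofReal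
      (hca'.integrableOn_Icc.mono_set Ioc_subset_Icc_self)
      (.of_forall fun t => poissonKernel₀_nonneg ha.le _),
    ← ofReal_integral_eq_lintegral_ofReal
      (hcb.integrableOn_Icc.mono_set Ioc_subset_Icc_self)
      (.of_forall fun t => poissonKernel₀_nonneg hb.le _),
    ← intervalIntegral.integral_of_le (by linarith), ← intervalIntegral.integral_of_le (by linarith)]
  exact ENNReal.ofReal_le_ofReal (integral_poissonKernel₀_shift_le hb hab hl)

lemma setLIntegral_poissonKernel₀_le_of_bounded {a b x R : ℝ} (hb : 0 < b) (hab : b ≤ a)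
    {S : Set ℝ} (hS : ∀ t ∈ S, ∀ s, |s| ≤ |t| → s ∈ S) (hR : ∀ t ∈ S, |t| ≤ R) :
    ∫⁻ t in S, ENNReal.ofReal (poissonKernel₀ a (x - t))
      ≤ ∫⁻ t in S, ENNReal.ofReal (poissonKernel₀ b t) := by
  rcases S.eq_empty_or_nonempty with rfl | ⟨t₀, ht₀⟩
  · simp
  have hbdd : BddAbove S := ⟨R, fun t ht => (le_abs_self t).trans (hR t ht)⟩
  have h0 : (0 : ℝ) ∈ S := hS t₀ ht₀ 0 (by simp)
  have hl : 0 ≤ sSup S := le_csSup hbdd h0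
  have hsub : S ⊆ Icc (-sSup S) (sSup S) := fun t ht =>
    abs_le.1 (le_csSup hbdd (hS t ht _ (by simp)))
  have hsup : Ioo (-sSup S) (sSup S) ⊆ S := fun t ht => by
    obtain ⟨u, hu, htu⟩ := exists_lt_of_lt_csSup ⟨t₀, ht₀⟩ (abs_lt.2 ht)
    exact hS u hu t (htu.le.trans (le_abs_self u))
  have hae : S =ᵐ[volume] Ioc (-sSup S) (sSup S) :=
    Filter.EventuallyLE.antisymm
      (hsub.eventuallyLE.trans Ioc_ae_eq_Icc.symm.le)
      (Ioo_ae_eq_Ioc.symm.le.trans hsup.eventuallyLE)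
  rw [setLIntegral_congr hae, setLIntegral_congr hae]
  exact setLIntegral_poissonKernel₀_Ioc_le hb hab hl

/-- Over a symmetric interval the integral of the Poisson kernel is largest when the
kernel is centred, and it increases as the pole approaches the boundary. -/
lemma setLIntegral_poissonKernel₀_le {a b x : ℝ} (hb : 0 < b) (hab : b ≤ a)
    {S : Set ℝ} (hS : ∀ t ∈ S, ∀ s, |s| ≤ |t| → s ∈ S) :
    ∫⁻ t in S, ENNReal.ofReal (poissonKernel₀ a (x - t))
      ≤ ∫⁻ t in S, ENNReal.ofReal (poissonKernel₀ b t) := by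
  have hU : S = ⋃ n : ℕ, S ∩ {t | |t| ≤ n} := by
    ext t
    simp only [mem_iUnion, mem_inter_iff, exists_and_left, iff_self_and]
    exact fun _ => exists_nat_ge |t|
  have hmono : Monotone fun n : ℕ => S ∩ {t : ℝ | |t| ≤ n} := fun m n hmn t ht =>
    ⟨ht.1, show |t| ≤ n from le_trans (show |t| ≤ m from ht.2) (by exact_mod_cast hmn)⟩
  conv_lhs => rw [hU]
  rw [setLIntegral_iUnion_of_directed _ hmono.directed_le]
  refine iSup_le fun n => ?_
  refine (setLIntegral_poissonKernel₀_le_of_bounded (R := n) hb hab ?_ fun t ht => ht.2).trans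
    (lintegral_mono_set inter_subset_left)
  exact fun t ht s hs => ⟨hS t ht.1 s hs, hs.trans ht.2⟩

/-- The weakly singular kernel `‖z‖ ^ (-3/2)`, in terms of the sup norm. -/
def singularKernel (z : ℝ × ℝ) : ℝ := (√‖z‖)⁻¹ ^ 3

lemma singularKernel_nonneg (z : ℝ × ℝ) : 0 ≤ singularKernel z := by
  unfold singularKernel; positivity

lemma measurable_singularKernel : Measurable singularKernel := by
  unfold singularKernel; fun_prop

lemma inv_norm_le_one_add_singularKernel (z : ℝ × ℝ) : ‖z‖⁻¹ ≤ 1 + singularKernel z := by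
  have h : ‖z‖⁻¹ = (√‖z‖)⁻¹ ^ 2 := by rw [inv_pow, sq_sqrt (norm_nonneg z)]
  unfold singularKernel
  rw [h]
  have hu : 0 ≤ (√‖z‖)⁻¹ := by positivity
  generalize (√‖z‖)⁻¹ = u at hu
  nlinarith [mul_nonneg hu (sq_nonneg (u - 1)), sq_nonneg (u - 1)]

lemma integrableOn_singularKernel_closedBall :
    IntegrableOn singularKernel (Metric.closedBall 0 1) volume := by
  set f : ℝ → ℝ := (Iic 1).indicator fun r => (√r)⁻¹ ^ 3 with hf
  have hfi : Integrable (fun z : ℝ × ℝ => f ‖z‖) volume := by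
    rw [integrable_fun_norm_addHaar]
    have h0 : IntegrableOn (fun y : ℝ => y ^ (-(1 / 2) : ℝ)) (Ioc 0 1) volume :=
      (intervalIntegrable_iff_integrableOn_Ioc_of_le zero_le_one).1
        (intervalIntegral.intervalIntegrable_rpow' (by norm_num))
    have h1 : IntegrableOn ((Iic (1 : ℝ)).indicator fun y : ℝ => y ^ (-(1 / 2) : ℝ)) (Ioi 0) := by
      rw [IntegrableOn, integrable_indicator_iff measurableSet_Iic, IntegrableOn,
        Measure.restrict_restrict measurableSet_Iic, inter_comm, Ioi_inter_Iic]
      exact h0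
    refine h1.congr_fun (fun y hy => ?_) measurableSet_Ioi
    have hy : 0 < y := hy
    by_cases h : y ≤ 1
    · have hd : Module.finrank ℝ (ℝ × ℝ) - 1 = 1 := by simp
      simp only [hf, indicator_of_mem (mem_Iic.2 h), hd, smul_eq_mul, pow_one]
      rw [rpow_neg hy.le, ← Real.sqrt_eq_rpow]
      have hs : 0 < √y := sqrt_pos.2 hy
      have hq : √y ^ 2 = y := sq_sqrt hy.le
      field_simp
      exact hq
    · simp [hf, h]
  refine (hfi.integrableOn (s := Metric.closedBall 0 1)).congr_fun (fun z hz => ?_)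
    measurableSet_closedBall
  have hz : ‖z‖ ≤ 1 := by simpa using hz
  simp [hf, hz, singularKernel]

/-- The potential of the kernel `‖z‖ ^ (-3/2)` is uniformly bounded on sets of measure
at most one. -/
lemma exists_setIntegral_singularKernel_le :
    ∃ C : ℝ, 0 ≤ C ∧ ∀ Ω : Set (ℝ × ℝ), MeasurableSet Ω → volume Ω ≤ 1 → ∀ x : ℝ × ℝ,
      IntegrableOn (fun y => singularKernel (x - y)) Ω ∧
        ∫ y in Ω, singularKernel (x - y) ≤ C := by
  set g : ℝ × ℝ → ℝ := (Metric.closedBall 0 1).indicator singularKernel with hg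
  have hgi : Integrable g volume :=
    (integrable_indicator_iff measurableSet_closedBall).2 integrableOn_singularKernel_closedBall
  have hg0 : ∀ z, 0 ≤ g z := fun z => indicator_nonneg (fun z _ => singularKernel_nonneg z) z
  have hle : ∀ z, singularKernel z ≤ 1 + g z := fun z => by
    by_cases h : z ∈ Metric.closedBall (0 : ℝ × ℝ) 1
    · simp [hg, h]
    · have h1 : 1 ≤ ‖z‖ := by
        have : ¬ ‖z‖ ≤ 1 := by simpa using h
        linarith
      have h2 : (√‖z‖)⁻¹ ≤ 1 := inv_le_one_of_one_le₀ (by simpa using h1)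
      have h3 : singularKernel z ≤ 1 := pow_le_one₀ (by positivity) h2
      linarith [hg0 z]
  refine ⟨1 + ∫ z, g z, add_nonneg zero_le_one (integral_nonneg hg0), fun Ω hΩ hv x => ?_⟩
  have hfin : volume Ω ≠ ⊤ := (hv.trans_lt ENNReal.one_lt_top).ne
  have hgx : Integrable (fun y => g (x - y)) volume := hgi.comp_sub_left x
  have hone : IntegrableOn (fun _ : ℝ × ℝ => (1 : ℝ)) Ω := integrableOn_const hfin
  have hdom : IntegrableOn (fun y => 1 + g (x - y)) Ω := hone.add hgx.integrableOn
  have hI : IntegrableOn (fun y => singularKernel (x - y)) Ω :=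
    hdom.mono' (measurable_singularKernel.comp (by fun_prop)).aestronglyMeasurable
      (.of_forall fun y => by
        rw [norm_of_nonneg (singularKernel_nonneg _)]
        exact hle _)
  refine ⟨hI, (integral_mono hI hdom fun y => hle _).trans ?_⟩
  rw [integral_add hone hgx.integrableOn]
  refine add_le_add ?_ ?_
  · simpa [Measure.real] using ENNReal.toReal_mono ENNReal.one_ne_top hv
  · calc ∫ y in Ω, g (x - y) ≤ ∫ y, g (x - y) :=
          setIntegral_le_integral hgx (.of_forall fun y => hg0 _)
      _ = ∫ z, g z := integral_sub_left_eq_self g volume x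

/-- The squared Euclidean distance. -/
def distSq (x y : ℝ × ℝ) : ℝ := (x.1 - y.1) ^ 2 + (x.2 - y.2) ^ 2

lemma distSq_comm (x y : ℝ × ℝ) : distSq x y = distSq y x := by
  unfold distSq; ring

lemma norm_sq_le_distSq (x y : ℝ × ℝ) : ‖x - y‖ ^ 2 ≤ distSq x y := by
  unfold distSq
  rw [Prod.norm_def]
  rcases max_choice ‖(x - y).1‖ ‖(x - y).2‖ with h | h <;> rw [h] <;>
    simp [sq_abs] <;> positivity

lemma distSq_nonneg (x y : ℝ × ℝ) : 0 ≤ distSq x y := by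
  unfold distSq; positivity

lemma distSq_pos {x y : ℝ × ℝ} (h : x ≠ y) : 0 < distSq x y :=
  lt_of_lt_of_le (by have := norm_pos_iff.2 (sub_ne_zero.2 h); positivity) (norm_sq_le_distSq x y)

lemma measurable_G : Measurable (fun p : (ℝ × ℝ) × (ℝ × ℝ) => G p.1 p.2) := by
  unfold G; fun_prop

lemma G_nonneg {x y : ℝ × ℝ} (hx : 0 ≤ x.2) (hy : 0 ≤ y.2) : 0 ≤ G x y := by
  unfold G
  have : 0 ≤ 4 * x.2 * y.2 / ((x.1 - y.1) ^ 2 + (x.2 - y.2) ^ 2) := by positivity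
  exact mul_nonneg (by positivity) (log_nonneg (by linarith))

lemma G_le {x y : ℝ × ℝ} (hx : 0 ≤ x.2) (hy : 0 ≤ y.2) : G x y ≤ x.2 * ‖x - y‖⁻¹ := by
  by_cases h : x = y
  · subst h; simp [G]
  have hr : 0 < ‖x - y‖ := norm_pos_iff.2 (sub_ne_zero.2 h)
  set r := ‖x - y‖ with hr'
  have hyx : y.2 ≤ x.2 + r := by
    have h2 : |(x - y).2| ≤ r := norm_snd_le (x - y)
    have := (abs_le.1 h2).1
    simp at this
    linarith
  have hd : 4 * x.2 * y.2 / distSq x y ≤ 4 * x.2 * (x.2 + r) / r ^ 2 := by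
    have := norm_sq_le_distSq x y
    gcongr
  have h1 : 1 + 4 * x.2 * y.2 / distSq x y ≤ (1 + 2 * (x.2 * r⁻¹)) ^ 2 := by
    refine (add_le_add_right hd 1).trans (le_of_eq ?_)
    field_simp
    ring
  have h0 : 0 < 1 + 4 * x.2 * y.2 / distSq x y := by
    have := distSq_nonneg x y
    positivity
  have h2 : Real.log (1 + 4 * x.2 * y.2 / distSq x y) ≤ 4 * (x.2 * r⁻¹) := by
    refine (log_le_log h0 h1).trans ?_
    have hp : 0 < 1 + 2 * (x.2 * r⁻¹) := by positivity
    rw [log_pow]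
    have := log_le_sub_one_of_pos hp
    push_cast
    linarith
  have h3 : G x y ≤ 1 / (4 * π) * (4 * (x.2 * r⁻¹)) := by
    unfold G
    exact mul_le_mul_of_nonneg_left h2 (by positivity)
  refine h3.trans ?_
  have h4 : 1 / (4 * π) * (4 * (x.2 * r⁻¹)) = (x.2 * r⁻¹) / π := by field_simp
  rw [h4]
  exact div_le_self (by positivity) (by linarith [pi_gt_three])

lemma le_G {x y : ℝ × ℝ} (hx : 0 < x.2) (hy : 0 < y.2) (h : x ≠ y) :
    x.2 / π * (y.2 / ((x.1 - y.1) ^ 2 + (x.2 + y.2) ^ 2)) ≤ G x y := by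
  have hd : 0 < (x.1 - y.1) ^ 2 + (x.2 - y.2) ^ 2 := distSq_pos h
  set t := 4 * x.2 * y.2 / ((x.1 - y.1) ^ 2 + (x.2 - y.2) ^ 2) with ht
  have ht0 : 0 < t := by positivity
  have h1 := one_sub_inv_le_log_of_pos (show 0 < 1 + t by linarith)
  have h2 : 1 - (1 + t)⁻¹ = 4 * x.2 * y.2 / ((x.1 - y.1) ^ 2 + (x.2 + y.2) ^ 2) := by
    have h3 : 1 + t = ((x.1 - y.1) ^ 2 + (x.2 + y.2) ^ 2) / ((x.1 - y.1) ^ 2 + (x.2 - y.2) ^ 2) := by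
      rw [ht]; field_simp; ring
    rw [h3, inv_div]
    field_simp
    ring
  rw [h2] at h1
  calc _ = 1 / (4 * π) * (4 * x.2 * y.2 / ((x.1 - y.1) ^ 2 + (x.2 + y.2) ^ 2)) := by field_simp
    _ ≤ _ := mul_le_mul_of_nonneg_left h1 (by positivity)

/-- The increment of `log |x - y|²` when `x` is moved down by `h`. -/
def logIncr (h : ℝ) (x y : ℝ × ℝ) : ℝ := Real.log (distSq (x - (0, h)) y / distSq x y)

lemma measurable_logIncr (h : ℝ) :
    Measurable (fun p : (ℝ × ℝ) × (ℝ × ℝ) => logIncr h p.1 p.2) := by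
  unfold logIncr distSq; fun_prop

lemma sq_add_shift_le {a b h r : ℝ} (hh : 0 ≤ h) (hr : 0 ≤ r) (hb : r ^ 2 ≤ a ^ 2 + b ^ 2) :
    (a ^ 2 + (b - h) ^ 2) * r ^ 2 ≤ (r + h) ^ 2 * (a ^ 2 + b ^ 2) := by
  have hbr : -b * r ^ 2 ≤ r * (a ^ 2 + b ^ 2) := by
    have h1 : |b| * r ≤ a ^ 2 + b ^ 2 := by
      have : |b| ^ 2 = b ^ 2 := sq_abs b
      nlinarith [sq_nonneg (|b| - r), sq_nonneg a]
    nlinarith [neg_abs_le b, mul_nonneg hr hr]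
  nlinarith [mul_le_mul_of_nonneg_left hb (sq_nonneg h), mul_le_mul_of_nonneg_left hbr hh]

lemma logIncr_le {h : ℝ} (hh : 0 ≤ h) (x y : ℝ × ℝ) : logIncr h x y ≤ 2 * h * ‖x - y‖⁻¹ := by
  have h0 : 0 ≤ 2 * h * ‖x - y‖⁻¹ := by positivity
  by_cases hxy : x = y
  · subst hxy; simp [logIncr, distSq]
  by_cases hxy' : x - (0, h) = y
  · rw [logIncr, hxy']; simpa [distSq] using h0
  have hr : 0 < ‖x - y‖ := norm_pos_iff.2 (sub_ne_zero.2 hxy)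
  have hd := distSq_pos hxy
  have hd' := distSq_pos hxy'
  have h1 : distSq (x - (0, h)) y / distSq x y ≤ (1 + h * ‖x - y‖⁻¹) ^ 2 := by
    rw [div_le_iff₀ hd]
    have := sq_add_shift_le hh hr.le (norm_sq_le_distSq x y)
    have he : (1 + h * ‖x - y‖⁻¹) ^ 2 = (‖x - y‖ + h) ^ 2 / ‖x - y‖ ^ 2 := by
      field_simp
    rw [he, div_mul_eq_mul_div, le_div_iff₀ (by positivity)]
    have e : distSq (x - (0, h)) y = (x.1 - y.1) ^ 2 + (x.2 - y.2 - h) ^ 2 := by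
      simp [distSq]; ring
    rw [e]
    exact this
  have h2 := log_le_log (div_pos hd' hd) h1
  rw [log_pow] at h2
  have h3 := log_le_sub_one_of_pos (show 0 < 1 + h * ‖x - y‖⁻¹ by positivity)
  unfold logIncr
  push_cast at h2
  linarith

lemma neg_logIncr_le {h : ℝ} (hh : 0 ≤ h) (x y : ℝ × ℝ) :
    -logIncr h x y ≤ 2 * h * ‖x - (0, h) - y‖⁻¹ := by
  have h1 : -logIncr h x y = logIncr h (x.1, -(x.2 - h)) (y.1, -y.2) := by
    unfold logIncr
    rw [← log_inv, inv_div]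
    congr 2 <;> simp [distSq] <;> ring
  rw [h1]
  refine (logIncr_le hh _ _).trans (le_of_eq ?_)
  congr 2
  simp only [Prod.norm_def, Prod.fst_sub, Prod.snd_sub, sub_zero]
  congr 1
  rw [← norm_neg]
  congr 1
  ring

lemma abs_logIncr_le {h : ℝ} (hh : 0 ≤ h) (x y : ℝ × ℝ) :
    |logIncr h x y| ≤ 2 * h * (‖x - y‖⁻¹ + ‖x - (0, h) - y‖⁻¹) := by
  have h1 := logIncr_le hh x y
  have h2 := neg_logIncr_le hh x y
  have h3 : 0 ≤ 2 * h * ‖x - y‖⁻¹ := by positivity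
  have h4 : 0 ≤ 2 * h * ‖x - (0, h) - y‖⁻¹ := by positivity
  rw [mul_add, abs_le]
  constructor <;> linarith

lemma log_one_add_pow_four_le {s : ℝ} (hs : 0 ≤ s) : Real.log (1 + s ^ 4) ≤ 4 * s ^ 3 := by
  rcases le_total s 1 with h | h
  · have h1 := log_le_sub_one_of_pos (show 0 < 1 + s ^ 4 by positivity)
    have h2 : s ^ 4 ≤ s ^ 3 := pow_le_pow_of_le_one hs h (by norm_num)
    have h3 : 0 ≤ s ^ 3 := by positivity
    linarith
  · have h1 : 1 + s ^ 4 ≤ (1 + s) ^ 4 := by nlinarith [pow_nonneg hs 2, pow_nonneg hs 3]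
    have h2 := log_le_log (by positivity) h1
    rw [log_pow] at h2
    have h3 := log_le_sub_one_of_pos (show 0 < 1 + s by positivity)
    have h4 : s ≤ s ^ 3 := by nlinarith [mul_nonneg hs hs]
    push_cast at h2
    linarith

/-- The symmetrization of `logIncr h` is of higher order in `h`. -/
lemma logIncr_add_swap_le {h : ℝ} (hh : 0 < h) (x y : ℝ × ℝ) :
    logIncr h x y + logIncr h y x ≤ 8 * √h ^ 3 * singularKernel (x - y) := by
  by_cases hxy : x = y
  · subst hxy
    simp [logIncr, distSq, singularKernel]
  have hr : 0 < ‖x - y‖ := norm_pos_iff.2 (sub_ne_zero.2 hxy)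
  have hd := distSq_pos hxy
  set s := √h * (√‖x - y‖)⁻¹ with hs
  have hs4 : s ^ 4 = h ^ 2 / ‖x - y‖ ^ 2 := by
    have e1 : √h ^ 4 = h ^ 2 := by rw [show (4 : ℕ) = 2 * 2 from rfl, pow_mul, sq_sqrt hh.le]
    have e2 : √‖x - y‖ ^ 4 = ‖x - y‖ ^ 2 := by
      rw [show (4 : ℕ) = 2 * 2 from rfl, pow_mul, sq_sqrt hr.le]
    rw [hs, mul_pow, inv_pow, e1, e2, div_eq_mul_inv]
  have hlog := log_one_add_pow_four_le (show 0 ≤ s by positivity)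
  have hmain : logIncr h x y + logIncr h y x ≤ 2 * Real.log (1 + s ^ 4) := by
    have hnn : 0 ≤ Real.log (1 + s ^ 4) := log_nonneg (by linarith [show 0 ≤ s ^ 4 by positivity])
    have hquot : h ^ 2 / distSq x y ≤ s ^ 4 := by
      rw [hs4]; gcongr; exact norm_sq_le_distSq x y
    have key : distSq (x - (0, h)) y * distSq (y - (0, h)) x ≤ (distSq x y + h ^ 2) ^ 2 := by
      simp only [distSq, Prod.fst_sub, Prod.snd_sub, sub_zero]
      nlinarith [sq_nonneg (h * (x.2 - y.2))]
    by_cases h1 : x - (0, h) = y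
    · have h2 : logIncr h x y = 0 := by rw [logIncr, h1]; simp [distSq]
      rw [h2, zero_add, logIncr]
      have hy : y = (x.1, x.2 - h) := by rw [← h1]; ext <;> simp
      have e1 : distSq y x = h ^ 2 := by rw [hy]; simp [distSq]
      have e2 : distSq (y - (0, h)) x = 4 * h ^ 2 := by rw [hy]; simp [distSq]; ring
      have e3 : distSq x y = h ^ 2 := by rw [distSq_comm, e1]
      have h4 : 1 ≤ s ^ 4 := by
        rw [e3, div_self (by positivity)] at hquot; exact hquot
      rw [e1, e2, mul_div_assoc, div_self (by positivity)]
      have h5 : Real.log (4 * 1) = 2 * Real.log 2 := by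
        rw [show (4 * 1 : ℝ) = 2 ^ 2 by norm_num, log_pow]; norm_num
      rw [h5]
      have := log_le_log (by norm_num : (0 : ℝ) < 2) (show 2 ≤ 1 + s ^ 4 by linarith)
      linarith
    by_cases h2 : y - (0, h) = x
    · have h3 : logIncr h y x = 0 := by rw [logIncr, h2]; simp [distSq]
      rw [h3, add_zero, logIncr]
      have hx : x = (y.1, y.2 - h) := by rw [← h2]; ext <;> simp
      have e1 : distSq x y = h ^ 2 := by rw [hx]; simp [distSq]
      have e2 : distSq (x - (0, h)) y = 4 * h ^ 2 := by rw [hx]; simp [distSq]; ring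
      have h4 : 1 ≤ s ^ 4 := by
        rw [e1, div_self (by positivity)] at hquot; exact hquot
      rw [e1, e2, mul_div_assoc, div_self (by positivity)]
      have h5 : Real.log (4 * 1) = 2 * Real.log 2 := by
        rw [show (4 * 1 : ℝ) = 2 ^ 2 by norm_num, log_pow]; norm_num
      rw [h5]
      have := log_le_log (by norm_num : (0 : ℝ) < 2) (show 2 ≤ 1 + s ^ 4 by linarith)
      linarith
    have p1 := distSq_pos h1
    have p2 := distSq_pos h2
    unfold logIncr
    rw [distSq_comm y x, ← log_mul (div_pos p1 hd).ne' (div_pos p2 hd).ne']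
    have h3 : distSq (x - (0, h)) y / distSq x y * (distSq (y - (0, h)) x / distSq x y)
        ≤ (1 + s ^ 4) ^ 2 := by
      calc _ = distSq (x - (0, h)) y * distSq (y - (0, h)) x / distSq x y ^ 2 := by
            field_simp
        _ ≤ (distSq x y + h ^ 2) ^ 2 / distSq x y ^ 2 := by gcongr
        _ = (1 + h ^ 2 / distSq x y) ^ 2 := by field_simp
        _ ≤ _ := by
          have : 0 ≤ h ^ 2 / distSq x y := by positivity
          gcongr
    have h4 := log_le_log (mul_pos (div_pos p1 hd) (div_pos p2 hd)) h3
    rw [log_pow] at h4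
    exact_mod_cast h4
  have hs3 : s ^ 3 = √h ^ 3 * singularKernel (x - y) := by
    rw [hs, mul_pow, singularKernel]
  rw [hs3] at hlog
  linarith

lemma G_sub_shift_le {h : ℝ} (hh : 0 < h) {x y : ℝ × ℝ} (hx : 2 * h < x.2) (hy : 0 < y.2)
    (hxy : x ≠ y) (hxy' : x - (0, h) ≠ y) :
    G x y - G (x - (0, h)) y ≤
      1 / (4 * π) * (3 * h * poissonKernel₀ (x.2 - h + y.2) (x.1 - y.1) + logIncr h x y) := by
  have hd := distSq_pos hxy
  have hd' := distSq_pos hxy'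
  set b := x.2 - h + y.2 with hb
  have hbh : h < b := by linarith
  have hb0 : 0 < b := by linarith
  set a := x.1 - y.1 with ha
  have hG : ∀ z : ℝ × ℝ, 0 < distSq z y → 0 < (z.1 - y.1) ^ 2 + (z.2 + y.2) ^ 2 →
      G z y = 1 / (4 * π) *
        (Real.log ((z.1 - y.1) ^ 2 + (z.2 + y.2) ^ 2) - Real.log (distSq z y)) := by
    intro z hz hz'
    rw [← log_div hz'.ne' hz.ne', G]
    congr 2
    unfold distSq at hz ⊢
    field_simp
    ring
  have e1 : x.2 + y.2 = b + h := by rw [hb]; ring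
  have hp1 : 0 < a ^ 2 + (b + h) ^ 2 := by positivity
  have hp2 : 0 < a ^ 2 + b ^ 2 := by positivity
  rw [hG x hd (by rw [e1]; exact hp1), hG (x - (0, h)) hd' (by
    simpa only [Prod.fst_sub, Prod.snd_sub, sub_zero] using hp2), ← mul_sub]
  simp only [Prod.fst_sub, Prod.snd_sub, sub_zero]
  rw [e1, ← ha, ← hb]
  refine mul_le_mul_of_nonneg_left ?_ (by positivity)
  rw [logIncr, log_div hd'.ne' hd.ne']
  have h1 : Real.log (a ^ 2 + (b + h) ^ 2) - Real.log (a ^ 2 + b ^ 2)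
      ≤ 3 * h * poissonKernel₀ b a := by
    rw [← log_div hp1.ne' hp2.ne']
    refine (log_le_sub_one_of_pos (div_pos hp1 hp2)).trans ?_
    unfold poissonKernel₀
    rw [div_sub_one hp2.ne', mul_div_assoc']
    gcongr
    nlinarith
  linarith

lemma setLIntegral_poissonKernel₀_shift_le {Ω : Set (ℝ × ℝ)} (hm : MeasurableSet Ω) (hH : Ω ⊆ H)
    {ω : ℝ × ℝ → ℝ} (hst : SteinerFn ω)
    (hω : ∀ᵐ x ∂volume.restrict H, ω x = Ω.indicator (fun _ => (1 : ℝ)) x)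
    {s : ℝ} (hs : 0 ≤ s) (x₁ : ℝ) :
    ∫⁻ y in Ω, ENNReal.ofReal (poissonKernel₀ (s + y.2) (x₁ - y.1))
      ≤ ∫⁻ y in Ω, ENNReal.ofReal (poissonKernel₀ y.2 y.1) := by
  have hHm : MeasurableSet H := measurableSet_lt measurable_const measurable_snd
  set S : ℝ → Set ℝ := fun r => {t | 1 / 2 < ω (t, r)} with hSdef
  have habs : ∀ r, 0 < r → ∀ t, ω (|t|, r) = ω (t, r) := fun r hr t => by
    rcases abs_choice t with h | h <;> rw [h]
    exact (hst.1 t r hr).symm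
  have hS : ∀ r, 0 < r → ∀ t ∈ S r, ∀ u, |u| ≤ |t| → u ∈ S r := fun r hr t ht u hu => by
    have h1 := hst.2 r hr |u| |t| (abs_nonneg u) hu
    rw [habs r hr, habs r hr] at h1
    exact lt_of_lt_of_le ht h1
  have hSm : ∀ r, 0 < r → MeasurableSet (S r) := fun r hr => by
    refine Set.OrdConnected.measurableSet ⟨fun a ha b hb c hc => ?_⟩
    rcases le_total |a| |b| with h | h
    · exact hS r hr b hb c (abs_le_max_abs_abs hc.1 hc.2 |>.trans (max_le h le_rfl))
    · exact hS r hr a ha c (abs_le_max_abs_abs hc.1 hc.2 |>.trans (max_le le_rfl h))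
  have hae : ∀ᵐ z : ℝ × ℝ, z.swap ∈ H → (z.swap ∈ Ω ↔ z.2 ∈ S z.1) := by
    rw [ae_restrict_iff' hHm] at hω
    have h1 : ∀ᵐ z : ℝ × ℝ, z ∈ H → (z ∈ Ω ↔ z.1 ∈ S z.2) := by
      filter_upwards [hω] with z hz hzH
      have h2 : ω (z.1, z.2) = _ := hz hzH
      by_cases hzΩ : z ∈ Ω
      · simp only [hzΩ, indicator_of_mem] at h2
        refine iff_of_true hzΩ ?_
        change 1 / 2 < ω (z.1, z.2)
        rw [h2]; norm_num
      · simp only [hzΩ, not_false_eq_true, indicator_of_notMem] at h2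
        refine iff_of_false hzΩ ?_
        change ¬ 1 / 2 < ω (z.1, z.2)
        rw [h2]; norm_num
    exact (Measure.measurePreserving_swap (μ := (volume : Measure ℝ))
      (ν := (volume : Measure ℝ))).quasiMeasurePreserving.ae h1
  have hae' := Measure.ae_ae_of_ae_prod hae
  have hslice : ∀ f : ℝ × ℝ → ENNReal, ∀ᵐ r : ℝ,
      ∫⁻ t, Ω.indicator f (t, r) = ∫⁻ t in S r, (Ioi (0 : ℝ)).indicator (fun r => f (t, r)) r := by
    intro f
    filter_upwards [hae'] with r hr
    by_cases hr0 : 0 < r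
    · rw [← lintegral_indicator (hSm r hr0)]
      refine lintegral_congr_ae ?_
      filter_upwards [hr] with t ht
      have ht' : (t, r) ∈ Ω ↔ t ∈ S r := ht hr0
      by_cases h : t ∈ S r
      · simp [h, ht'.2 h, hr0]
      · simp [h, mt ht'.1 h]
    · have : ∀ t, (t, r) ∉ Ω := fun t ht => hr0 (hH ht)
      simp [this, hr0]
  have hmeas : ∀ f : ℝ × ℝ → ℝ, Measurable f →
      ∫⁻ y in Ω, ENNReal.ofReal (f y)
        = ∫⁻ r, ∫⁻ t, Ω.indicator (fun y => ENNReal.ofReal (f y)) (t, r) := fun f hf => by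
    rw [← lintegral_indicator hm, Measure.volume_eq_prod,
      lintegral_prod_symm _ ((hf.ennreal_ofReal.indicator hm).aemeasurable)]
  rw [hmeas _ (by unfold poissonKernel₀; fun_prop), hmeas _ (by unfold poissonKernel₀; fun_prop)]
  refine lintegral_mono_ae ?_
  filter_upwards [hslice fun y => ENNReal.ofReal (poissonKernel₀ (s + y.2) (x₁ - y.1)),
    hslice fun y => ENNReal.ofReal (poissonKernel₀ y.2 y.1)] with r h1 h2
  rw [h1, h2]
  by_cases hr0 : 0 < r
  · simp only [mem_Ioi, hr0, indicator_of_mem]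
    exact setLIntegral_poissonKernel₀_le hr0 (by linarith) (hS r hr0)
  · simp [hr0]

lemma integrable_prod_of_forall_integral_le {α : Type*} [MeasurableSpace α] {μ ν : Measure α}
    [IsFiniteMeasure μ] [IsFiniteMeasure ν] {f : α × α → ℝ} (hf : Measurable f)
    (h0 : ∀ p, 0 ≤ f p) {C : ℝ} (hi : ∀ x, Integrable (fun y => f (x, y)) ν)
    (hC : ∀ x, ∫ y, f (x, y) ∂ν ≤ C) : Integrable f (μ.prod ν) := by
  rw [integrable_prod_iff hf.aestronglyMeasurable]
  refine ⟨.of_forall hi, ?_⟩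
  refine Integrable.of_bound (hf.norm.stronglyMeasurable.integral_prod_right').aestronglyMeasurable
    C (.of_forall fun x => ?_)
  have he : ∫ y, ‖f (x, y)‖ ∂ν = ∫ y, f (x, y) ∂ν := by
    congr 1; ext y; exact norm_of_nonneg (h0 _)
  rw [he, norm_of_nonneg (integral_nonneg fun y => h0 _)]
  exact hC x

lemma poissonKernel₀_le_inv_norm (y : ℝ × ℝ) : poissonKernel₀ y.2 y.1 ≤ ‖y‖⁻¹ := by
  by_cases hy : y = 0
  · simp [hy, poissonKernel₀]
  have hr : 0 < ‖y‖ := norm_pos_iff.2 hy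
  have h1 : ‖y‖ ^ 2 ≤ y.1 ^ 2 + y.2 ^ 2 := by simpa [distSq] using norm_sq_le_distSq y 0
  have h2 : y.2 ≤ ‖y‖ := (le_abs_self _).trans (norm_snd_le y)
  calc y.2 / (y.1 ^ 2 + y.2 ^ 2) ≤ ‖y‖ / ‖y‖ ^ 2 := by gcongr
    _ = ‖y‖⁻¹ := by field_simp

lemma integrableOn_inv_norm_sub {Ω : Set (ℝ × ℝ)} (hv : volume Ω ≤ 1) {C : ℝ} {x : ℝ × ℝ}
    (hC : IntegrableOn (fun y => singularKernel (x - y)) Ω ∧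
      ∫ y in Ω, singularKernel (x - y) ≤ C) :
    IntegrableOn (fun y => ‖x - y‖⁻¹) Ω ∧ ∫ y in Ω, ‖x - y‖⁻¹ ≤ 1 + C := by
  have hone : IntegrableOn (fun _ : ℝ × ℝ => (1 : ℝ)) Ω :=
    integrableOn_const (hv.trans_lt ENNReal.one_lt_top).ne
  have hm : Measurable fun y : ℝ × ℝ => ‖x - y‖⁻¹ := by fun_prop
  have hI : IntegrableOn (fun y => ‖x - y‖⁻¹) Ω :=
    (hone.add hC.1).mono' hm.aestronglyMeasurable (.of_forall fun y => by
      rw [norm_of_nonneg (by positivity)]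
      exact inv_norm_le_one_add_singularKernel _)
  refine ⟨hI, (integral_mono hI (hone.add hC.1)
    fun y => inv_norm_le_one_add_singularKernel (x - y)).trans ?_⟩
  simp only [Pi.add_apply]
  rw [integral_add hone hC.1]
  refine add_le_add ?_ hC.2
  simpa [Measure.real] using ENNReal.toReal_mono ENNReal.one_ne_top hv

lemma setIntegral_logIncr_le {Ω D : Set (ℝ × ℝ)} (hm : MeasurableSet Ω) (hv : volume Ω ≤ 1)
    (hDm : MeasurableSet D) (hDΩ : D ⊆ Ω) {C : ℝ}
    (hC : ∀ Ω : Set (ℝ × ℝ), MeasurableSet Ω → volume Ω ≤ 1 → ∀ x : ℝ × ℝ,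
      IntegrableOn (fun y => singularKernel (x - y)) Ω ∧
        ∫ y in Ω, singularKernel (x - y) ≤ C) {h : ℝ} (hh : 0 < h) :
    IntegrableOn (fun x => ∫ y in Ω, logIncr h x y) (Ω \ D) ∧
    ∫ x in Ω \ D, ∫ y in Ω, logIncr h x y
      ≤ 4 * √h ^ 3 * C + 2 * h * ((1 + C) * volume.real D) := by
  have hAm : MeasurableSet (Ω \ D) := hm.diff hDm
  have hAΩ : Ω \ D ⊆ Ω := sdiff_subset
  have hvD : volume D ≤ 1 := (measure_mono hDΩ).trans hv
  have hvA : volume (Ω \ D) ≤ 1 := (measure_mono hAΩ).trans hv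
  have fin : ∀ {B : Set (ℝ × ℝ)}, volume B ≤ 1 → IsFiniteMeasure (volume.restrict B) := fun hB =>
    ⟨by simpa using hB.trans_lt ENNReal.one_lt_top⟩
  have := fin hv
  have := fin hvD
  have := fin hvA
  have hC0 : 0 ≤ C := (integral_nonneg fun y => singularKernel_nonneg _).trans (hC Ω hm hv 0).2
  have hkI : ∀ {B B' : Set (ℝ × ℝ)}, MeasurableSet B' → volume B ≤ 1 → volume B' ≤ 1 →
      Integrable (fun p : (ℝ × ℝ) × (ℝ × ℝ) => logIncr h p.1 p.2)
        ((volume.restrict B).prod (volume.restrict B')) := by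
    intro B B' hB' hvB hvB'
    have := fin hvB
    have := fin hvB'
    have h1 : Integrable (fun p : (ℝ × ℝ) × (ℝ × ℝ) => ‖p.1 - p.2‖⁻¹)
        ((volume.restrict B).prod (volume.restrict B')) :=
      integrable_prod_of_forall_integral_le (C := 1 + C) (by fun_prop) (fun p => by positivity)
        (fun x => (integrableOn_inv_norm_sub hvB' (hC B' hB' hvB' x)).1)
        fun x => (integrableOn_inv_norm_sub hvB' (hC B' hB' hvB' x)).2
    have h2 : Integrable (fun p : (ℝ × ℝ) × (ℝ × ℝ) => ‖p.1 - (0, h) - p.2‖⁻¹)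
        ((volume.restrict B).prod (volume.restrict B')) :=
      integrable_prod_of_forall_integral_le (C := 1 + C) (by fun_prop) (fun p => by positivity)
        (fun x => (integrableOn_inv_norm_sub hvB' (hC B' hB' hvB' (x - (0, h)))).1)
        fun x => (integrableOn_inv_norm_sub hvB' (hC B' hB' hvB' (x - (0, h)))).2
    exact ((h1.add h2).const_mul (2 * h)).mono' (measurable_logIncr h).aestronglyMeasurable
      (.of_forall fun p => abs_logIncr_le hh.le p.1 p.2)
  have hkx : ∀ x, ∀ {B : Set (ℝ × ℝ)}, MeasurableSet B → volume B ≤ 1 →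
      IntegrableOn (fun y => logIncr h x y) B := by
    intro x B hB hvB
    exact (((integrableOn_inv_norm_sub hvB (hC B hB hvB x)).1.add
      (integrableOn_inv_norm_sub hvB (hC B hB hvB (x - (0, h)))).1).const_mul (2 * h)).mono'
        ((measurable_logIncr h).comp measurable_prodMk_left).aestronglyMeasurable
        (.of_forall fun y => abs_logIncr_le hh.le x y)
  have hsplit : ∀ x, ∫ y in Ω, logIncr h x y
      = (∫ y in Ω \ D, logIncr h x y) + ∫ y in D, logIncr h x y := fun x => by
    rw [← setIntegral_union disjoint_sdiff_left hDm (hkx x hAm hvA) (hkx x hDm hvD),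
      sdiff_union_of_subset hDΩ]
  have hIA := hkI (B := Ω \ D) hAm hvA hvA
  have hID := hkI (B := Ω \ D) hDm hvA hvD
  refine ⟨(hkI (B := Ω \ D) hm hvA hv).integral_prod_left, ?_⟩
  simp_rw [hsplit]
  rw [integral_add hIA.integral_prod_left hID.integral_prod_left]
  refine add_le_add ?_ ?_
  · have hsym : ∫ x in Ω \ D, ∫ y in Ω \ D, logIncr h x y
        = ∫ x in Ω \ D, ∫ y in Ω \ D, logIncr h y x :=
      integral_integral_swap (f := fun x y => logIncr h x y) hIA
    have hsI : Integrable (fun p : (ℝ × ℝ) × (ℝ × ℝ) => singularKernel (p.1 - p.2))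
        ((volume.restrict (Ω \ D)).prod (volume.restrict (Ω \ D))) :=
      integrable_prod_of_forall_integral_le (C := C) (measurable_singularKernel.comp (by fun_prop))
        (fun p => singularKernel_nonneg _) (fun x => (hC _ hAm hvA x).1)
        fun x => (hC _ hAm hvA x).2
    have hsum : (∫ x in Ω \ D, ∫ y in Ω \ D, logIncr h x y)
        + ∫ x in Ω \ D, ∫ y in Ω \ D, logIncr h y x
        ≤ 8 * √h ^ 3 * C := by
      have e1 := integral_prod (fun p : (ℝ × ℝ) × (ℝ × ℝ) => logIncr h p.1 p.2) hIA
      have e2 := integral_prod (fun p : (ℝ × ℝ) × (ℝ × ℝ) => logIncr h p.2 p.1) hIA.swap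
      have e3 := integral_prod (fun p : (ℝ × ℝ) × (ℝ × ℝ) => singularKernel (p.1 - p.2)) hsI
      have h4 := integral_mono (hIA.add hIA.swap) (hsI.const_mul (8 * √h ^ 3))
        fun p => logIncr_add_swap_le hh p.1 p.2
      have h5 := integral_add hIA hIA.swap
      simp only [Pi.add_apply, Function.comp_def, Prod.fst_swap, Prod.snd_swap] at h4 h5
      rw [← e1, ← e2, ← h5]
      refine h4.trans ?_
      rw [integral_const_mul, e3]
      refine mul_le_mul_of_nonneg_left ?_ (by positivity)
      refine (integral_mono hsI.integral_prod_left (integrable_const C)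
        fun x => (hC _ hAm hvA x).2).trans ?_
      have hν : volume.real (Ω \ D) ≤ 1 := by
        simpa [Measure.real] using ENNReal.toReal_mono ENNReal.one_ne_top hvA
      simpa using mul_le_mul_of_nonneg_right hν hC0
    linarith
  · have hKI : Integrable (fun p : (ℝ × ℝ) × (ℝ × ℝ) => ‖p.1 - p.2‖⁻¹)
        ((volume.restrict (Ω \ D)).prod (volume.restrict D)) :=
      integrable_prod_of_forall_integral_le (C := 1 + C) (by fun_prop) (fun p => by positivity)
        (fun x => (integrableOn_inv_norm_sub hvD (hC D hDm hvD x)).1)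
        fun x => (integrableOn_inv_norm_sub hvD (hC D hDm hvD x)).2
    have h1 : ∫ x in Ω \ D, ∫ y in D, logIncr h x y
        ≤ ∫ x in Ω \ D, ∫ y in D, 2 * h * ‖x - y‖⁻¹ := by
      refine integral_mono hID.integral_prod_left (hKI.const_mul (2 * h)).integral_prod_left
        fun x => ?_
      exact integral_mono (hkx x hDm hvD)
        ((integrableOn_inv_norm_sub hvD (hC D hDm hvD x)).1.const_mul (2 * h))
        fun y => logIncr_le hh.le x y
    refine h1.trans ?_
    simp_rw [integral_const_mul]
    refine mul_le_mul_of_nonneg_left ?_ (by positivity)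
    rw [integral_integral_swap (f := fun x y : ℝ × ℝ => ‖x - y‖⁻¹) hKI]
    have h2 : ∀ y, ∫ x in Ω \ D, ‖x - y‖⁻¹ ≤ 1 + C := fun y => by
      simp_rw [norm_sub_rev _ y]
      exact (integrableOn_inv_norm_sub hvA (hC _ hAm hvA y)).2
    refine (integral_mono hKI.integral_prod_right (integrable_const (1 + C)) h2).trans ?_
    simp [mul_comm]

section PatchPotential

variable {Ω : Set (ℝ × ℝ)} {C : ℝ}

lemma integrableOn_G (hm : MeasurableSet Ω) (hH : Ω ⊆ H)
    {x : ℝ × ℝ} (hx : 0 ≤ x.2) (hI : IntegrableOn (fun y => ‖x - y‖⁻¹) Ω) :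
    IntegrableOn (G x) Ω := by
  refine (hI.const_mul x.2).mono' (measurable_G.comp measurable_prodMk_left).aestronglyMeasurable ?_
  filter_upwards [ae_restrict_mem hm] with y hy
  rw [norm_of_nonneg (G_nonneg hx (hH hy).le)]
  exact G_le hx (hH hy).le

lemma setIntegral_G_le (hm : MeasurableSet Ω) (hH : Ω ⊆ H) {x : ℝ × ℝ} (hx : 0 ≤ x.2)
    (hI : IntegrableOn (fun y => ‖x - y‖⁻¹) Ω ∧ ∫ y in Ω, ‖x - y‖⁻¹ ≤ C) :
    ∫ y in Ω, G x y ≤ x.2 * C := by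
  refine (setIntegral_mono_on (integrableOn_G hm hH hx hI.1) (hI.1.const_mul x.2) hm
    fun y hy => G_le hx (hH hy).le).trans ?_
  rw [integral_const_mul]
  exact mul_le_mul_of_nonneg_left hI.2 hx

/-- If a positive superlevel set of `f` is shifted, the integral of `f` does not increase. -/
lemma setIntegral_comp_sub_le {A : Set (ℝ × ℝ)} {f : ℝ × ℝ → ℝ} (hm : MeasurableSet Ω)
    (hf : IntegrableOn f Ω) (hpos : ∀ x ∈ Ω, 0 < f x) {v : ℝ × ℝ} (hA : MeasurableSet A)
    (hneg : ∀ x ∈ A, x - v ∉ Ω → f (x - v) ≤ 0)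
    (hfA : IntegrableOn (fun x => f (x - v)) A) :
    ∫ x in A, f (x - v) ≤ ∫ x in Ω, f x := by
  set F := Ω.indicator f with hF
  have hFi : Integrable F volume := (integrable_indicator_iff hm).2 hf
  have hF0 : ∀ x, 0 ≤ F x := fun x => indicator_nonneg (fun y hy => (hpos y hy).le) x
  have hFv : Integrable (fun x => F (x - v)) volume := hFi.comp_sub_right v
  calc ∫ x in A, f (x - v) ≤ ∫ x in A, F (x - v) := by
        refine setIntegral_mono_on hfA hFv.integrableOn hA fun x hx => ?_
        by_cases h : x - v ∈ Ω
        · simp [hF, h]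
        · simpa [hF, h] using hneg x hx h
    _ ≤ ∫ x, F (x - v) := setIntegral_le_integral hFv (.of_forall fun x => hF0 _)
    _ = ∫ x, F x := integral_sub_right_eq_self F v
    _ = ∫ x in Ω, f x := integral_indicator hm

lemma setIntegral_poissonKernel₀_shift_le (hm : MeasurableSet Ω) (hH : Ω ⊆ H)
    (hI : IntegrableOn (fun y => ‖y‖⁻¹) Ω) {s x₁ : ℝ} (hs : 0 ≤ s)
    (hk : ∫⁻ y in Ω, ENNReal.ofReal (poissonKernel₀ (s + y.2) (x₁ - y.1))
      ≤ ∫⁻ y in Ω, ENNReal.ofReal (poissonKernel₀ y.2 y.1)) :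
    IntegrableOn (fun y => poissonKernel₀ (s + y.2) (x₁ - y.1)) Ω ∧
    ∫ y in Ω, poissonKernel₀ (s + y.2) (x₁ - y.1) ≤ ∫ y in Ω, poissonKernel₀ y.2 y.1 := by
  have hJm : Measurable fun y : ℝ × ℝ => poissonKernel₀ y.2 y.1 := by
    unfold poissonKernel₀; fun_prop
  have hm' : Measurable fun y : ℝ × ℝ => poissonKernel₀ (s + y.2) (x₁ - y.1) := by
    unfold poissonKernel₀; fun_prop
  have h0 : ∀ᵐ y ∂volume.restrict Ω, 0 ≤ poissonKernel₀ y.2 y.1 := by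
    filter_upwards [ae_restrict_mem hm] with y hy using poissonKernel₀_nonneg (hH hy).le _
  have h0' : ∀ᵐ y ∂volume.restrict Ω, 0 ≤ poissonKernel₀ (s + y.2) (x₁ - y.1) := by
    filter_upwards [ae_restrict_mem hm] with y hy using
      poissonKernel₀_nonneg (add_nonneg hs (hH hy).le) _
  have hJ : IntegrableOn (fun y => poissonKernel₀ y.2 y.1) Ω := by
    refine hI.mono' hJm.aestronglyMeasurable ?_
    filter_upwards [h0] with y hy
    rw [norm_of_nonneg hy]
    exact poissonKernel₀_le_inv_norm y
  have hlt : ∫⁻ y in Ω, ENNReal.ofReal (poissonKernel₀ y.2 y.1) < ⊤ := by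
    rw [← hasFiniteIntegral_iff_ofReal h0]; exact hJ.2
  refine ⟨⟨hm'.aestronglyMeasurable, (hasFiniteIntegral_iff_ofReal h0').2 (hk.trans_lt hlt)⟩, ?_⟩
  rw [integral_eq_lintegral_of_nonneg_ae h0 hJm.aestronglyMeasurable,
    integral_eq_lintegral_of_nonneg_ae h0' hm'.aestronglyMeasurable]
  exact ENNReal.toReal_mono hlt.ne hk

lemma translation_speed_le_aux (hm : MeasurableSet Ω) (hH : Ω ⊆ H) (hv : volume Ω ≤ 1)
    (hx₂ : IntegrableOn (fun x : ℝ × ℝ => x.2) Ω) {W : ℝ} (hW : 0 ≤ W)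
    (hΩ : Ω = {x ∈ H | 0 < (∫ y in Ω, G x y) - W * x.2})
    (hC : ∀ Ω : Set (ℝ × ℝ), MeasurableSet Ω → volume Ω ≤ 1 → ∀ x : ℝ × ℝ,
      IntegrableOn (fun y => singularKernel (x - y)) Ω ∧
        ∫ y in Ω, singularKernel (x - y) ≤ C)
    (hk : ∀ s : ℝ, 0 ≤ s → ∀ x₁ : ℝ,
      ∫⁻ y in Ω, ENNReal.ofReal (poissonKernel₀ (s + y.2) (x₁ - y.1))
        ≤ ∫⁻ y in Ω, ENNReal.ofReal (poissonKernel₀ y.2 y.1))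
    {h : ℝ} (hh : 0 < h) :
    W * volume.real (Ω \ {x | x.2 ≤ 2 * h}) ≤
      1 / (4 * π) * (3 * (∫ y in Ω, poissonKernel₀ y.2 y.1) *
        volume.real (Ω \ {x | x.2 ≤ 2 * h}) + 4 * √h * C +
          2 * ((1 + C) * volume.real (Ω ∩ {x | x.2 ≤ 2 * h})))
        + 2 * ((1 + C) * volume.real (Ω ∩ {x | x.2 ≤ 2 * h})) := by
  set D := Ω ∩ {x : ℝ × ℝ | x.2 ≤ 2 * h} with hD
  have hAD : Ω \ {x : ℝ × ℝ | x.2 ≤ 2 * h} = Ω \ D := by rw [hD, sdiff_self_inter]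
  rw [hAD]
  have hDm : MeasurableSet D := hm.inter (measurableSet_le measurable_snd measurable_const)
  have hDΩ : D ⊆ Ω := inter_subset_left
  have hAm : MeasurableSet (Ω \ D) := hm.diff hDm
  have hAΩ : Ω \ D ⊆ Ω := sdiff_subset
  have hmemA : ∀ x ∈ Ω \ D, 2 * h < x.2 := fun x hx => by
    by_contra hcon
    exact hx.2 ⟨hx.1, not_lt.1 hcon⟩
  have : IsFiniteMeasure (volume.restrict Ω) :=
    ⟨by simpa using hv.trans_lt ENNReal.one_lt_top⟩
  have : IsFiniteMeasure (volume.restrict (Ω \ D)) :=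
    ⟨by simpa using ((measure_mono hAΩ).trans hv).trans_lt ENNReal.one_lt_top⟩
  have : IsFiniteMeasure (volume.restrict D) :=
    ⟨by simpa using ((measure_mono hDΩ).trans hv).trans_lt ENNReal.one_lt_top⟩
  have hN := fun x => integrableOn_inv_norm_sub hv (hC Ω hm hv x)
  have hC0 : 0 ≤ C := (integral_nonneg fun y => singularKernel_nonneg _).trans (hC Ω hm hv 0).2
  set J := ∫ y in Ω, poissonKernel₀ y.2 y.1 with hJ
  set P : ℝ × ℝ → ℝ := fun x => ∫ y in Ω, G x y with hP
  have hPm : Measurable P := (StronglyMeasurable.integral_prod_right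
    (f := G) measurable_G.stronglyMeasurable).measurable
  have hP0 : ∀ x : ℝ × ℝ, 0 ≤ x.2 → 0 ≤ P x := fun x hx =>
    setIntegral_nonneg hm fun y hy => G_nonneg hx (hH hy).le
  have hPle : ∀ x : ℝ × ℝ, 0 ≤ x.2 → P x ≤ x.2 * (1 + C) := fun x hx =>
    setIntegral_G_le hm hH hx (hN x)
  have hPΩ : IntegrableOn P Ω := by
    refine (hx₂.mul_const (1 + C)).mono' hPm.aestronglyMeasurable ?_
    filter_upwards [ae_restrict_mem hm] with x hx
    rw [norm_of_nonneg (hP0 x (hH hx).le)]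
    exact hPle x (hH hx).le
  have hPA : IntegrableOn (fun x => P (x - (0, h))) (Ω \ D) := by
    refine ((hx₂.mono_set hAΩ).mul_const (1 + C)).mono'
      (hPm.comp (by fun_prop)).aestronglyMeasurable ?_
    filter_upwards [ae_restrict_mem hAm] with x hx
    have h1 := hmemA x hx
    have h2 : (x - (0, h)).2 = x.2 - h := by simp
    rw [norm_of_nonneg (hP0 _ (by rw [h2]; linarith))]
    refine (hPle _ (by rw [h2]; linarith)).trans ?_
    rw [h2]
    gcongr
    linarith
  have hψΩ : IntegrableOn (fun x => P x - W * x.2) Ω := hPΩ.sub (hx₂.const_mul W)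
  have hxA : IntegrableOn (fun x : ℝ × ℝ => (x - (0, h)).2) (Ω \ D) := by
    simp only [Prod.snd_sub]
    exact (hx₂.mono_set hAΩ).sub (integrable_const h)
  have hψA : IntegrableOn (fun x => P (x - (0, h)) - W * (x - (0, h)).2) (Ω \ D) :=
    hPA.sub (hxA.const_mul W)
  have hshift : ∫ x in Ω \ D, (P (x - (0, h)) - W * (x - (0, h)).2)
      ≤ ∫ x in Ω, (P x - W * x.2) := by
    refine setIntegral_comp_sub_le (f := fun x => P x - W * x.2) hm hψΩ
      (fun x hx => ?_) hAm (fun x hx hxn => ?_) hψA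
    · rw [hΩ] at hx; exact hx.2
    · by_contra hcon
      refine hxn ?_
      rw [hΩ]
      refine ⟨?_, not_le.1 hcon⟩
      change 0 < (x - (0, h)).2
      have := hmemA x hx
      simp only [Prod.snd_sub]
      linarith
  have hsplit : ∫ x in Ω, (P x - W * x.2)
      = (∫ x in Ω \ D, (P x - W * x.2)) + ∫ x in D, (P x - W * x.2) := by
    rw [← setIntegral_union disjoint_sdiff_left hDm (hψΩ.mono_set hAΩ) (hψΩ.mono_set hDΩ),
      sdiff_union_of_subset hDΩ]
  have hψD : ∫ x in D, (P x - W * x.2) ≤ 2 * h * ((1 + C) * volume.real D) := by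
    refine (setIntegral_mono_on (hψΩ.mono_set hDΩ) (integrable_const (2 * h * (1 + C))) hDm
      fun x hx => ?_).trans (le_of_eq ?_)
    · have hx0 : 0 < x.2 := hH hx.1
      have hx2 : x.2 ≤ 2 * h := hx.2
      have h1 := hPle x hx0.le
      have h2 : x.2 * (1 + C) ≤ 2 * h * (1 + C) := by gcongr
      have h3 : 0 ≤ W * x.2 := by positivity
      linarith
    · simp; ring
  have hdiff : (∫ x in Ω \ D, (P x - W * x.2))
      - ∫ x in Ω \ D, (P (x - (0, h)) - W * (x - (0, h)).2)
      = (∫ x in Ω \ D, (P x - P (x - (0, h)))) - W * h * volume.real (Ω \ D) := by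
    rw [← integral_sub (hψΩ.mono_set hAΩ) hψA]
    have e : ∀ x : ℝ × ℝ, P x - W * x.2 - (P (x - (0, h)) - W * (x - (0, h)).2)
        = P x - P (x - (0, h)) - W * h := fun x => by
      simp only [Prod.snd_sub]; ring
    simp_rw [e]
    have hi : IntegrableOn (fun x => P x - P (x - (0, h))) (Ω \ D) := (hPΩ.mono_set hAΩ).sub hPA
    rw [integral_sub hi (integrable_const _)]
    simp; ring
  obtain ⟨hKI, hKle⟩ := setIntegral_logIncr_le hm hv hDm hDΩ hC hh
  have hPd : ∫ x in Ω \ D, (P x - P (x - (0, h)))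
      ≤ ∫ x in Ω \ D, (1 / (4 * π) * (3 * h * J + ∫ y in Ω, logIncr h x y)) := by
    refine setIntegral_mono_on ((hPΩ.mono_set hAΩ).sub hPA)
      (((integrable_const (3 * h * J)).add hKI).const_mul _) hAm fun x hx => ?_
    have hx2 := hmemA x hx
    have hx' : (x - (0, h)).2 = x.2 - h := by simp
    have hG1 := integrableOn_G hm hH (by linarith : 0 ≤ x.2) (hN x).1
    have hx0' : 0 ≤ (x - ((0 : ℝ), h)).2 := by rw [hx']; linarith
    have hG2 := integrableOn_G hm hH hx0' (hN _).1
    obtain ⟨hp1, hp2⟩ := setIntegral_poissonKernel₀_shift_le hm hH (by simpa using (hN 0).1)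
      (by linarith : 0 ≤ x.2 - h) (hk (x.2 - h) (by linarith) x.1)
    have hki : IntegrableOn (fun y => logIncr h x y) Ω :=
      (((hN x).1.add (hN (x - (0, h))).1).const_mul (2 * h)).mono'
        ((measurable_logIncr h).comp measurable_prodMk_left).aestronglyMeasurable
        (.of_forall fun y => abs_logIncr_le hh.le x y)
    rw [hP]
    simp only []
    rw [← integral_sub hG1 hG2]
    have hne : ∀ z : ℝ × ℝ, ∀ᵐ y ∂volume.restrict Ω, z ≠ y := fun z => by
      filter_upwards [ae_restrict_of_ae (Measure.ae_ne volume z)] with y hy using hy.symm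
    calc ∫ y in Ω, (G x y - G (x - (0, h)) y)
        ≤ ∫ y in Ω, 1 / (4 * π) *
          (3 * h * poissonKernel₀ (x.2 - h + y.2) (x.1 - y.1) + logIncr h x y) := by
          refine integral_mono_ae (hG1.sub hG2) (((hp1.const_mul (3 * h)).add hki).const_mul _) ?_
          filter_upwards [ae_restrict_mem hm, hne x, hne (x - (0, h))] with y hy h1 h2
          exact G_sub_shift_le hh hx2 (hH hy) h1 h2
      _ = 1 / (4 * π) * (3 * h * (∫ y in Ω, poissonKernel₀ (x.2 - h + y.2) (x.1 - y.1))
          + ∫ y in Ω, logIncr h x y) := by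
          rw [integral_const_mul, integral_add (hp1.const_mul (3 * h)) hki, integral_const_mul]
      _ ≤ _ := by gcongr
  have hPd' : ∫ x in Ω \ D, (1 / (4 * π) * (3 * h * J + ∫ y in Ω, logIncr h x y))
      = 1 / (4 * π) * (3 * h * J * volume.real (Ω \ D) +
        ∫ x in Ω \ D, ∫ y in Ω, logIncr h x y) := by
    rw [integral_const_mul, integral_add (integrable_const _) hKI]
    simp [mul_comm]
  have hsq : √h ^ 3 = h * √h := by rw [pow_succ, sq_sqrt hh.le]
  rw [hsq] at hKle
  have hfin : h * (W * volume.real (Ω \ D)) ≤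
      1 / (4 * π) * (3 * h * J * volume.real (Ω \ D) +
        (4 * (h * √h) * C + 2 * h * ((1 + C) * volume.real D)))
        + 2 * h * ((1 + C) * volume.real D) := by
    have h1 := mul_le_mul_of_nonneg_left hKle (show 0 ≤ 1 / (4 * π) by positivity)
    rw [mul_add] at hPd' ⊢
    linarith
  refine le_of_mul_le_mul_left (hfin.trans (le_of_eq ?_)) hh
  ring

/-- The translation speed of a patch is at most three quarters of the velocity at the origin. -/
lemma translation_speed_le (hm : MeasurableSet Ω) (hH : Ω ⊆ H) (hv : volume Ω ≤ 1)
    (hv0 : volume Ω ≠ 0)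
    (hx₂ : IntegrableOn (fun x : ℝ × ℝ => x.2) Ω) {W : ℝ} (hW : 0 ≤ W)
    (hΩ : Ω = {x ∈ H | 0 < (∫ y in Ω, G x y) - W * x.2})
    (hk : ∀ s : ℝ, 0 ≤ s → ∀ x₁ : ℝ,
      ∫⁻ y in Ω, ENNReal.ofReal (poissonKernel₀ (s + y.2) (x₁ - y.1))
        ≤ ∫⁻ y in Ω, ENNReal.ofReal (poissonKernel₀ y.2 y.1)) :
    W ≤ 3 / (4 * π) * ∫ y in Ω, poissonKernel₀ y.2 y.1 := by
  obtain ⟨C, -, hC⟩ := exists_setIntegral_singularKernel_le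
  set J := ∫ y in Ω, poissonKernel₀ y.2 y.1 with hJ
  have hvt : volume Ω ≠ ⊤ := (hv.trans_lt ENNReal.one_lt_top).ne
  set η : ℕ → ℝ := fun n => 1 / ((n : ℝ) + 1) with hη
  have hη0 : ∀ n, 0 < η n := fun n => by positivity
  have hηlim : Tendsto η atTop (𝓝 0) := tendsto_one_div_add_atTop_nhds_zero_nat
  set D : ℕ → Set (ℝ × ℝ) := fun n => Ω ∩ {x | x.2 ≤ 2 * η n} with hD
  have hDm : ∀ n, MeasurableSet (D n) := fun n =>
    hm.inter (measurableSet_le measurable_snd measurable_const)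
  have hDanti : Antitone D := fun m n hmn x hx => by
    refine ⟨hx.1, le_trans (show x.2 ≤ 2 * η n from hx.2) ?_⟩
    have : η n ≤ η m := one_div_le_one_div_of_le (by positivity) (by gcongr)
    linarith
  have hDinter : ⋂ n, D n = ∅ := by
    refine eq_empty_of_forall_notMem fun x hx => ?_
    rw [mem_iInter] at hx
    have hx0 : 0 < x.2 := hH (hx 0).1
    have h1 : x.2 ≤ 2 * 0 :=
      ge_of_tendsto' (hηlim.const_mul 2) fun n => (show x.2 ≤ 2 * η n from (hx n).2)
    linarith
  have hDlim : Tendsto (fun n => volume.real (D n)) atTop (𝓝 0) := by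
    have h1 := tendsto_measure_iInter_atTop (μ := volume) (fun n => (hDm n).nullMeasurableSet)
      hDanti ⟨0, measure_ne_top_of_subset inter_subset_left hvt⟩
    rw [hDinter, measure_empty] at h1
    have h2 := (ENNReal.tendsto_toReal ENNReal.zero_ne_top).comp h1
    rwa [ENNReal.toReal_zero] at h2
  have hAlim : Tendsto (fun n => volume.real (Ω \ {x | x.2 ≤ 2 * η n})) atTop
      (𝓝 (volume.real Ω)) := by
    have h1 : ∀ n, volume.real (Ω \ {x | x.2 ≤ 2 * η n}) = volume.real Ω - volume.real (D n) :=
      fun n => by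
        rw [← measureReal_sdiff inter_subset_left (hDm n), sdiff_self_inter]
    simp_rw [h1]
    simpa using tendsto_const_nhds.sub hDlim
  have hsq : Tendsto (fun n => √(η n)) atTop (𝓝 0) := by
    simpa using hηlim.sqrt
  have hineq := fun n => translation_speed_le_aux hm hH hv hx₂ hW hΩ hC hk (hη0 n)
  have hlim := le_of_tendsto_of_tendsto' (hAlim.const_mul W)
    (((((hAlim.const_mul (3 * J)).add ((hsq.const_mul 4).mul_const C)).add
      ((hDlim.const_mul (1 + C)).const_mul 2)).const_mul (1 / (4 * π))).add
      ((hDlim.const_mul (1 + C)).const_mul 2)) hineq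
  have hpos : 0 < volume.real Ω := ENNReal.toReal_pos hv0 hvt
  refine le_of_mul_le_mul_right (hlim.trans (le_of_eq ?_)) hpos
  ring

/-- If the velocity at the origin exceeds `W`, then so does `𝒢[1_Ω](x) / x₂` near the origin. -/
lemma exists_forall_lt_setIntegral_G (hm : MeasurableSet Ω) (hH : Ω ⊆ H) (hv : volume Ω ≤ 1)
    {W : ℝ} (hW : W < 1 / π * ∫ y in Ω, poissonKernel₀ y.2 y.1) (hW0 : 0 < W) :
    ∃ ε : ℝ, 0 < ε ∧ ∀ x ∈ H, x.1 ^ 2 + x.2 ^ 2 < ε ^ 2 → W * x.2 < ∫ y in Ω, G x y := by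
  obtain ⟨C, -, hC⟩ := exists_setIntegral_singularKernel_le
  have hN := fun x => integrableOn_inv_norm_sub hv (hC Ω hm hv x)
  have hJm : Measurable fun y : ℝ × ℝ => poissonKernel₀ y.2 y.1 := by
    unfold poissonKernel₀; fun_prop
  have h0 : ∀ᵐ y ∂volume.restrict Ω, 0 ≤ poissonKernel₀ y.2 y.1 := by
    filter_upwards [ae_restrict_mem hm] with y hy using poissonKernel₀_nonneg (hH hy).le _
  have hmeas : ∀ x : ℝ × ℝ, Measurable fun y : ℝ × ℝ =>
      ENNReal.ofReal (y.2 / ((x.1 - y.1) ^ 2 + (x.2 + y.2) ^ 2)) := fun x => by fun_prop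
  have hW' : ENNReal.ofReal (π * W) < ∫⁻ y in Ω, ENNReal.ofReal (poissonKernel₀ y.2 y.1) := by
    have h1 : π * W < ∫ y in Ω, poissonKernel₀ y.2 y.1 := by
      have := mul_lt_mul_of_pos_left hW Real.pi_pos
      rwa [← mul_assoc, mul_one_div_cancel Real.pi_ne_zero, one_mul] at this
    rw [integral_eq_lintegral_of_nonneg_ae h0 hJm.aestronglyMeasurable] at h1
    exact (ENNReal.ofReal_lt_iff_lt_toReal (by positivity) (fun h => by
      rw [h] at h1
      simp only [ENNReal.toReal_top] at h1
      linarith [mul_pos Real.pi_pos hW0])).2 h1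
  have hfatou := lintegral_liminf_le (μ := volume.restrict Ω) (u := 𝓝 (0 : ℝ × ℝ)) hmeas
  have hpt : ∫⁻ y in Ω, ENNReal.ofReal (poissonKernel₀ y.2 y.1)
      = ∫⁻ y in Ω, liminf (fun x : ℝ × ℝ =>
        ENNReal.ofReal (y.2 / ((x.1 - y.1) ^ 2 + (x.2 + y.2) ^ 2))) (𝓝 0) := by
    refine setLIntegral_congr_fun hm fun y hy => ?_
    have hy0 : 0 < y.2 := hH hy
    have hne : ((0 : ℝ × ℝ).1 - y.1) ^ 2 + ((0 : ℝ × ℝ).2 + y.2) ^ 2 ≠ 0 := by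
      simp only [Prod.fst_zero, Prod.snd_zero]
      positivity
    have hc : ContinuousAt (fun x : ℝ × ℝ => y.2 / ((x.1 - y.1) ^ 2 + (x.2 + y.2) ^ 2)) 0 :=
      continuousAt_const.div (by fun_prop) hne
    have ht := (ENNReal.continuous_ofReal.tendsto _).comp hc.tendsto
    refine Eq.trans ?_ ht.liminf_eq.symm
    simp [poissonKernel₀]
  rw [← hpt] at hfatou
  have hev := eventually_lt_of_lt_liminf (hW'.trans_le hfatou)
  obtain ⟨ε, hε, hball⟩ := Metric.eventually_nhds_iff.1 hev
  refine ⟨ε, hε, fun x hx hxε => ?_⟩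
  have hx0 : 0 < x.2 := hx
  have hdist : dist x 0 < ε := by
    rw [dist_eq_norm]
    refine lt_of_pow_lt_pow_left₀ 2 hε.le (lt_of_le_of_lt (norm_sq_le_distSq x 0) ?_)
    simpa [distSq] using hxε
  have hlt := hball hdist
  have hqm : Measurable fun y : ℝ × ℝ => y.2 / ((x.1 - y.1) ^ 2 + (x.2 + y.2) ^ 2) := by fun_prop
  have hq0 : ∀ᵐ y ∂volume.restrict Ω, 0 ≤ y.2 / ((x.1 - y.1) ^ 2 + (x.2 + y.2) ^ 2) := by
    filter_upwards [ae_restrict_mem hm] with y hy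
    have : 0 < y.2 := hH hy
    positivity
  have hGi := integrableOn_G hm hH hx0.le (hN x).1
  have hle : ∀ᵐ y ∂volume.restrict Ω,
      x.2 / π * (y.2 / ((x.1 - y.1) ^ 2 + (x.2 + y.2) ^ 2)) ≤ G x y := by
    filter_upwards [ae_restrict_mem hm, ae_restrict_of_ae (Measure.ae_ne volume x)] with y hy hne
    exact le_G hx0 (hH hy) hne.symm
  have hqi : IntegrableOn (fun y : ℝ × ℝ => y.2 / ((x.1 - y.1) ^ 2 + (x.2 + y.2) ^ 2)) Ω := by
    refine (hGi.const_mul (π / x.2)).mono' hqm.aestronglyMeasurable ?_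
    filter_upwards [hle, hq0] with y h1 h2
    rw [norm_of_nonneg h2]
    have := mul_le_mul_of_nonneg_left h1 (show 0 ≤ π / x.2 by positivity)
    rwa [← mul_assoc, div_mul_div_cancel₀ hx0.ne', div_self Real.pi_ne_zero, one_mul] at this
  rw [← ofReal_integral_eq_lintegral_ofReal hqi hq0] at hlt
  have hlt' := (ENNReal.ofReal_lt_ofReal_iff_of_nonneg (by positivity)).1 hlt
  have h_le := integral_mono_ae (hqi.const_mul (x.2 / π)) hGi hle
  rw [integral_const_mul] at h_le
  refine lt_of_lt_of_le ?_ h_le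
  calc W * x.2 = x.2 / π * (π * W) := by field_simp
    _ < _ := mul_lt_mul_of_pos_left hlt' (by positivity)

end PatchPotential

/-- touching of the dipole: for sufficiently small impulse, every
Steiner-symmetric maximizer with vanishing flux constant contains a half-disc around
the origin in its positivity set. -/
theorem touching_of_dipole :
    ∃ M₁ : ℝ, 0 < M₁ ∧ ∀ M : ℝ, 0 < M → M < M₁ →
      ∀ ω : ℝ × ℝ → ℝ, memS M ω → SteinerFn ω → ∀ W : ℝ, 0 < W →
        (∀ᵐ x ∂volume.restrict H,
          ω x = Set.indicator {y ∈ H | 0 < Gpot ω y - W * y.2} (fun _ => (1 : ℝ)) x) →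
        ∃ ε : ℝ, 0 < ε ∧
          {x ∈ H | x.1 ^ 2 + x.2 ^ 2 < ε ^ 2} ⊆ {x ∈ H | 0 < Gpot ω x - W * x.2} := by
  refine ⟨1, one_pos, fun M hM _ ω hS hst W hW hω => ?_⟩
  obtain ⟨⟨-, A, hAH, hAm, hωA, hAM, hA1⟩, -⟩ := hS
  have hHm : MeasurableSet H := measurableSet_lt measurable_const measurable_snd
  set Ω : Set (ℝ × ℝ) := {y ∈ H | 0 < Gpot ω y - W * y.2} with hΩdef
  have hH : Ω ⊆ H := fun x hx => hx.1
  have hpot : ∀ B : Set (ℝ × ℝ), B ⊆ H → MeasurableSet B →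
      (∀ᵐ x ∂volume.restrict H, ω x = B.indicator (fun _ => (1 : ℝ)) x) →
      ∀ x, Gpot ω x = ∫ y in B, G x y := fun B hBH hBm hB x => by
    calc Gpot ω x = ∫ y in H, B.indicator (G x) y := by
          refine integral_congr_ae ?_
          filter_upwards [hB] with y hy
          rw [hy]
          by_cases h : y ∈ B <;> simp [h]
      _ = ∫ y in B, G x y := by
          rw [setIntegral_indicator hBm, inter_eq_self_of_subset_right hBH]
  have hPm : Measurable (Gpot ω) := by
    rw [funext (hpot A hAH hAm hωA)]
    exact (StronglyMeasurable.integral_prod_right (f := G)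
      measurable_G.stronglyMeasurable).measurable
  have hΩm : MeasurableSet Ω :=
    hHm.inter (measurableSet_lt measurable_const (hPm.sub (measurable_snd.const_mul W)))
  have hAΩ : A =ᵐ[volume] Ω := by
    rw [ae_restrict_iff' hHm] at hωA hω
    filter_upwards [hωA, hω] with x h1 h2
    refine propext (?_ : x ∈ A ↔ x ∈ Ω)
    by_cases hx : x ∈ H
    · have h3 := (h1 hx).symm.trans (h2 hx)
      by_cases hA : x ∈ A <;> by_cases hΩ : x ∈ Ω
      · exact iff_of_true hA hΩ
      · rw [indicator_of_mem hA, indicator_of_notMem hΩ] at h3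
        exact absurd h3 one_ne_zero
      · rw [indicator_of_notMem hA, indicator_of_mem hΩ] at h3
        exact absurd h3 zero_ne_one
      · exact iff_of_false hA hΩ
    · exact iff_of_false (fun h => hx (hAH h)) fun h => hx (hH h)
  have hv : volume Ω ≤ 1 := by rwa [← measure_congr hAΩ]
  have hΩM : ∫ x in Ω, x.2 = M := by rw [← setIntegral_congr_set hAΩ, hAM]
  have hv0 : volume Ω ≠ 0 := fun h => by
    rw [Measure.restrict_eq_zero.2 h, integral_zero_measure] at hΩM
    exact hM.ne hΩM
  have hx₂ : IntegrableOn (fun x : ℝ × ℝ => x.2) Ω := by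
    by_contra h
    rw [integral_undef h] at hΩM
    exact hM.ne hΩM
  have hP := hpot Ω hH hΩm hω
  have hspeed := translation_speed_le hΩm hH hv hv0 hx₂ hW.le
    (by simp_rw [← hP]; exact hΩdef)
    fun s hs x₁ => setLIntegral_poissonKernel₀_shift_le hΩm hH hst hω hs x₁
  have hlt : W < 1 / π * ∫ y in Ω, poissonKernel₀ y.2 y.1 := by
    rw [show 1 / π = 4 / 3 * (3 / (4 * π)) by field_simp, mul_assoc]
    linarith
  obtain ⟨ε, hε, h⟩ := exists_forall_lt_setIntegral_G hΩm hH hv hlt hW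
  refine ⟨ε, hε, fun x hx => ⟨hx.1, ?_⟩⟩
  rw [hP, sub_pos]
  exact h x hx.1 hx.2
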